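/- Fix weights μ_i > 0 and τ_j > 0 and assume (A3). Then for all (x¹, y¹), (x², y²) ∈ R^n × R^m one has Σ_{j=1}^m τ_j sgn(y²_j − y¹_j) (F₂,j(x², y²) − F₂,j(x¹, y¹)) ≤ Σ_{j=1}^m [ Σ_{i≠j} (τ_i/τ_j)(|l_ij| + b̃_ij) + |l_jj| − λ b̲_jj − l_jj ] τ_j |y²_j − y¹_j| + Σ_{i=1}^n Σ_{j=1}^m τ_j λ b̃*_ji |x²_i − x¹_i|. -/

import Mathlib

noncomputable def clamp (s c d : ℝ) : ℝ := min (max s c) d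

noncomputable def sgn (t : ℝ) : ℝ := if 0 < t then 1 else if t < 0 then -1 else 0

theorem abs_clamp_sub_clamp_le (s t c d : ℝ) : |clamp s c d - clamp t c d| ≤ |s - t| := by
  unfold clamp
  calc |min (max s c) d - min (max t c) d| ≤ max |max s c - max t c| |d - d| :=
        abs_min_sub_min_le_max _ _ _ _
    _ = |max s c - max t c| := by simp
    _ ≤ max |s - t| |c - c| := abs_max_sub_max_le_max _ _ _ _
    _ = |s - t| := by simp

theorem sgn_mul_self (t : ℝ) : sgn t * t = |t| := by
  unfold sgn
  split_ifs with h h'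
  · rw [abs_of_pos h, one_mul]
  · rw [abs_of_neg h']; ring
  · simp [le_antisymm (not_lt.mp h) (not_lt.mp h')]

theorem sgn_mul_le_abs (t s : ℝ) : sgn t * s ≤ |s| := by
  unfold sgn
  split_ifs
  · simpa using le_abs_self s
  · simpa using neg_le_abs s
  · simp

theorem abs_mul_add_le_max {lam c lo hi v : ℝ} (hlam : 0 ≤ lam) (hlo : lo ≤ v) (hhi : v ≤ hi) :
    |lam * v + c| ≤ max |lam * lo + c| |lam * hi + c| :=
  abs_le_max_abs_abs (by gcongr) (by gcongr)

theorem abs_sum_mul_le {ι : Type*} (s : Finset ι) (a c e : ι → ℝ) (h : ∀ i ∈ s, |a i| ≤ c i) :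
    |∑ i ∈ s, a i * e i| ≤ ∑ i ∈ s, c i * |e i| := by
  refine (Finset.abs_sum_le_sum_abs _ _).trans (Finset.sum_le_sum fun i hi => ?_)
  rw [abs_mul]
  exact mul_le_mul_of_nonneg_right (h i hi) (abs_nonneg _)

theorem Finset.sum_sum_erase_comm {ι : Type*} [Fintype ι] [DecidableEq ι] (f : ι → ι → ℝ) :
    ∑ j, ∑ i ∈ Finset.univ.erase j, f j i = ∑ j, ∑ i ∈ Finset.univ.erase j, f i j :=
  Finset.sum_comm' (by simp [eq_comm])

/-- The one-sided estimate for a single coordinate: `e` is the increment of that coordinate, `p` and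
`q` the off-diagonal contributions outside and inside the clamp, and `r` the external input. -/
theorem sgn_mul_clamp_row_le {e a k D p q r P Q R : ℝ} (hk : k + a ≤ 1)
    (hD : |D| ≤ |e - ((k + a) * e + q) - r|) (hp : |p| ≤ P) (hq : |q| ≤ Q) (hr : |r| ≤ R) :
    sgn e * ((a * e + p) + D - e) ≤ P + Q + (|a| - k - a) * |e| + R := by
  rcases eq_or_ne e 0 with rfl | he
  · have h0 : sgn 0 = 0 := by simp [sgn]
    rw [h0]
    have := abs_nonneg p
    have := abs_nonneg q
    have := abs_nonneg r
    simp only [abs_zero, mul_zero, zero_mul]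
    linarith
  · have h1 : |D| ≤ (1 - (k + a)) * |e| + |q| + |r| := by
      refine hD.trans ?_
      have h : e - ((k + a) * e + q) - r = (1 - (k + a)) * e - q - r := by ring
      rw [h]
      have h2 := abs_sub ((1 - (k + a)) * e - q) r
      have h3 := abs_sub ((1 - (k + a)) * e) q
      rw [abs_mul, abs_of_nonneg (by linarith : 0 ≤ 1 - (k + a))] at h3
      linarith
    have h2 := sgn_mul_le_abs e p
    have h3 := sgn_mul_le_abs e D
    have h4 := sgn_mul_self e
    have h5 : a * |e| ≤ |a| * |e| := mul_le_mul_of_nonneg_right (le_abs_self a) (abs_nonneg e)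
    have h6 : sgn e * ((a * e + p) + D - e)
        = a * (sgn e * e) + sgn e * p + sgn e * D - sgn e * e := by ring
    rw [h6, h4]
    linarith

theorem stmt8
    (n m : ℕ) (hn : 0 < n) (hm : 0 < m)
    (lam : ℝ) (hlam : 0 < lam)
    (b : Fin m → ℝ)
    (Bl Bu B : Fin m → Fin m → ℝ)
    (Bsl Bsu Bs : Fin m → Fin n → ℝ)
    (hBb : ∀ i j, Bl i j ≤ B i j ∧ B i j ≤ Bu i j)
    (hBsb : ∀ j i, Bsl j i ≤ Bs j i ∧ Bs j i ≤ Bsu j i)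
    (l : Fin m → Fin m → ℝ)
    (d1 d2 : Fin m → ℝ) (hd : ∀ j, d1 j ≤ d2 j)
    (btil : Fin m → Fin m → ℝ)
    (hbtil : ∀ i j, btil i j = max |lam * Bl i j + l i j| |lam * Bu i j + l i j|)
    (bstil : Fin m → Fin n → ℝ)
    (hbstil : ∀ j i, bstil j i = max |Bsl j i| |Bsu j i|)
    (hA3 : ∀ j, 1 - lam * Bu j j ≥ l j j)
    (μ : Fin n → ℝ) (τ : Fin m → ℝ)
    (hμ : ∀ i, 0 < μ i) (hτ : ∀ j, 0 < τ j)
    (F2 : (Fin n → ℝ) → (Fin m → ℝ) → Fin m → ℝ)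
    (hF2 : ∀ x y j, F2 x y j = (∑ i, l j i * y i)
        + clamp (y j - (∑ i, (lam * B j i + l j i) * y i)
            - (∑ i, lam * Bs j i * x i) - lam * b j) (d1 j) (d2 j) - y j)
    :
    ∀ (x1 x2 : Fin n → ℝ) (y1 y2 : Fin m → ℝ),
      (∑ j, τ j * sgn (y2 j - y1 j) * (F2 x2 y2 j - F2 x1 y1 j))
        ≤ (∑ j, ((∑ i ∈ Finset.univ.erase j, (τ i / τ j) * (|l i j| + btil i j))
              + |l j j| - lam * Bl j j - l j j) * (τ j * |y2 j - y1 j|))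
          + (∑ i, ∑ j, τ j * (lam * bstil j i) * |x2 i - x1 i|) := by
  intro x1 x2 y1 y2
  have row : ∀ j, sgn (y2 j - y1 j) * (F2 x2 y2 j - F2 x1 y1 j)
      ≤ (∑ i ∈ Finset.univ.erase j, (|l j i| + btil j i) * |y2 i - y1 i|)
        + (|l j j| - lam * Bl j j - l j j) * |y2 j - y1 j|
        + ∑ i, lam * bstil j i * |x2 i - x1 i| := by
    intro j
    have hsplit : ∀ a : Fin m → ℝ, (∑ i, a i * y2 i) - ∑ i, a i * y1 i
        = a j * (y2 j - y1 j) + ∑ i ∈ Finset.univ.erase j, a i * (y2 i - y1 i) := by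
      intro a
      rw [Finset.add_sum_erase _ (fun i => a i * (y2 i - y1 i)) (Finset.mem_univ j),
        ← Finset.sum_sub_distrib]
      exact Finset.sum_congr rfl fun i _ => by ring
    have hx : (∑ i, lam * Bs j i * x2 i) - ∑ i, lam * Bs j i * x1 i
        = ∑ i, lam * Bs j i * (x2 i - x1 i) := by
      rw [← Finset.sum_sub_distrib]
      exact Finset.sum_congr rfl fun i _ => by ring
    have hL := hsplit (l j)
    have hB := hsplit fun i => lam * B j i + l j i
    have hp := abs_sum_mul_le (Finset.univ.erase j) (l j) (fun i => |l j i|)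
      (fun i => y2 i - y1 i) fun _ _ => le_rfl
    have hq := abs_sum_mul_le (Finset.univ.erase j) (fun i => lam * B j i + l j i) (btil j)
      (fun i => y2 i - y1 i) fun i _ => by
        rw [hbtil]
        exact abs_mul_add_le_max hlam.le (hBb j i).1 (hBb j i).2
    have hr := abs_sum_mul_le Finset.univ (fun i => lam * Bs j i) (fun i => lam * bstil j i)
      (fun i => x2 i - x1 i) fun i _ => by
        rw [hbstil, abs_mul, abs_of_pos hlam]
        exact mul_le_mul_of_nonneg_left (abs_le_max_abs_abs (hBsb j i).1 (hBsb j i).2) hlam.le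
    have hclamp := abs_clamp_sub_clamp_le
      (y2 j - (∑ i, (lam * B j i + l j i) * y2 i) - (∑ i, lam * Bs j i * x2 i) - lam * b j)
      (y1 j - (∑ i, (lam * B j i + l j i) * y1 i) - (∑ i, lam * Bs j i * x1 i) - lam * b j)
      (d1 j) (d2 j)
    have hk : lam * B j j + l j j ≤ 1 := by
      have := mul_le_mul_of_nonneg_left (hBb j j).2 hlam.le
      have := hA3 j
      linarith
    have hdiag : lam * Bl j j * |y2 j - y1 j| ≤ lam * B j j * |y2 j - y1 j| :=
      mul_le_mul_of_nonneg_right (mul_le_mul_of_nonneg_left (hBb j j).1 hlam.le) (abs_nonneg _)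
    have key := sgn_mul_clamp_row_le hk
      (hclamp.trans_eq (congrArg abs (by rw [← hB, ← hx]; ring))) hp hq hr
    rw [← hL] at key
    have hsum : ∑ i ∈ Finset.univ.erase j, (|l j i| + btil j i) * |y2 i - y1 i|
        = (∑ i ∈ Finset.univ.erase j, |l j i| * |y2 i - y1 i|)
          + ∑ i ∈ Finset.univ.erase j, btil j i * |y2 i - y1 i| := by
      rw [← Finset.sum_add_distrib]
      exact Finset.sum_congr rfl fun i _ => by ring
    rw [hsum]
    refine le_trans (le_of_eq ?_) (key.trans ?_)
    · rw [hF2, hF2]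
      ring
    · linarith
  have hoff : ∑ j, τ j * ∑ i ∈ Finset.univ.erase j, (|l j i| + btil j i) * |y2 i - y1 i|
      = ∑ j, (∑ i ∈ Finset.univ.erase j, (τ i / τ j) * (|l i j| + btil i j))
          * (τ j * |y2 j - y1 j|) := by
    simp_rw [Finset.mul_sum]
    rw [Finset.sum_sum_erase_comm]
    refine Finset.sum_congr rfl fun j _ => ?_
    rw [Finset.sum_mul]
    refine Finset.sum_congr rfl fun i _ => ?_
    have := (hτ j).ne'
    field_simp
  have hext : ∑ j, τ j * ∑ i, lam * bstil j i * |x2 i - x1 i|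
      = ∑ i, ∑ j, τ j * (lam * bstil j i) * |x2 i - x1 i| := by
    rw [Finset.sum_comm]
    refine Finset.sum_congr rfl fun j _ => ?_
    rw [Finset.mul_sum]
    exact Finset.sum_congr rfl fun i _ => by ring
  rw [← hext]
  calc _ ≤ ∑ j, τ j * ((∑ i ∈ Finset.univ.erase j, (|l j i| + btil j i) * |y2 i - y1 i|)
        + (|l j j| - lam * Bl j j - l j j) * |y2 j - y1 j|
        + ∑ i, lam * bstil j i * |x2 i - x1 i|) :=
        Finset.sum_le_sum fun j _ => by
          rw [mul_assoc]
          exact mul_le_mul_of_nonneg_left (row j) (hτ j).le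
    _ = _ := by
      simp_rw [mul_add (τ _), Finset.sum_add_distrib]
      rw [hoff, ← Finset.sum_add_distrib]
      congr 1
      exact Finset.sum_congr rfl fun j _ => by ring
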